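/- Let {(x_n, y_n)}_{n=0}^∞ be a solution of the system with positive initial conditions. Then for each fixed i ≥ 0, the sequence {y_{i+n} / μ(i, n+2)}_{n=0}^∞ is strictly increasing; indeed y_{i+n+1}/μ(i,n+3) = x_{i+n}/μ(i,n+3) + y_{i+n}/μ(i,n+2) for all n ≥ 0. -/

import Mathlib

open Filter Topology

/-- The coefficient sequence extended to `ℤ` by the convention `γ₋₁ := γ₀`. -/
noncomputable def gext (γ : ℕ → ℝ) : ℤ → ℝ := fun j => if j < 0 then γ 0 else γ j.toNat

/-- `μ(i,1) = 1` and `μ(i,k) = ∏_{j=i-1}^{i+k-3} γ_j` for `k ≥ 2`. -/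
noncomputable def mu (γ : ℕ → ℝ) (i k : ℕ) : ℝ :=
  ∏ t ∈ Finset.range (k - 1), gext γ ((i : ℤ) - 1 + (t : ℤ))

/-- `φ(i,n) = ∑_{k=1}^n μ(i,k) x_{i+k}`. -/
noncomputable def phi (γ x : ℕ → ℝ) (i n : ℕ) : ℝ :=
  ∑ k ∈ Finset.Icc 1 n, mu γ i k * x (i + k)

/-- `w_n = (γ_{n-1} + x_n)/y_n`, where `γ₋₁ := γ₀` (Nat subtraction). -/
noncomputable def wseq (γ x y : ℕ → ℝ) (n : ℕ) : ℝ := (γ (n - 1) + x n) / y n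

lemma gext_pos {γ : ℕ → ℝ} (hγ : ∀ n, 0 < γ n) (j : ℤ) : 0 < gext γ j := by
  unfold gext
  split_ifs <;> exact hγ _

lemma mu_pos {γ : ℕ → ℝ} (hγ : ∀ n, 0 < γ n) (i k : ℕ) : 0 < mu γ i k :=
  Finset.prod_pos fun _ _ => gext_pos hγ _

lemma mu_add_three (γ : ℕ → ℝ) (i n : ℕ) :
    mu γ i (n + 3) = mu γ i (n + 2) * γ (i + n) := by
  have hidx : (i : ℤ) - 1 + ((n + 1 : ℕ) : ℤ) = ((i + n : ℕ) : ℤ) := by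
    push_cast
    ring
  have hg : gext γ ((i + n : ℕ) : ℤ) = γ (i + n) := by
    rw [gext, if_neg (by omega), Int.toNat_natCast]
  change ∏ t ∈ Finset.range (n + 1 + 1), _ = (∏ t ∈ Finset.range (n + 1), _) * _
  rw [Finset.prod_range_succ, hidx, hg]

/-- Solutions with positive initial conditions stay positive. -/
lemma solution_pos {γ x y : ℕ → ℝ} (hγ : ∀ n, 0 < γ n) (hx0 : 0 < x 0) (hy0 : 0 < y 0)
    (hx : ∀ n, x (n + 1) = x n / y n) (hy : ∀ n, y (n + 1) = x n + γ n * y n) (n : ℕ) :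
    0 < x n ∧ 0 < y n := by
  induction n with
  | zero => exact ⟨hx0, hy0⟩
  | succ n ih =>
    obtain ⟨hxn, hyn⟩ := ih
    have hγn := hγ n
    rw [hx, hy]
    constructor <;> positivity

/-- For every solution with positive initial conditions and each fixed `i`, the sequence
`n ↦ y_{i+n}/μ(i,n+2)` is strictly increasing; indeed
`y_{i+n+1}/μ(i,n+3) = x_{i+n}/μ(i,n+3) + y_{i+n}/μ(i,n+2)` for all `n`. -/
theorem stmt17 (γ x y : ℕ → ℝ)
    (hγpos : ∀ n, 0 < γ n)
    (hx0 : 0 < x 0) (hy0 : 0 < y 0)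
    (hx : ∀ n, x (n + 1) = x n / y n)
    (hy : ∀ n, y (n + 1) = x n + γ n * y n) :
    ∀ i : ℕ,
      StrictMono (fun n => y (i + n) / mu γ i (n + 2)) ∧
      ∀ n : ℕ, y (i + n + 1) / mu γ i (n + 3) =
        x (i + n) / mu γ i (n + 3) + y (i + n) / mu γ i (n + 2) := by
  intro i
  have hrec : ∀ n : ℕ, y (i + n + 1) / mu γ i (n + 3) =
      x (i + n) / mu γ i (n + 3) + y (i + n) / mu γ i (n + 2) := by
    intro n
    have hμ := (mu_pos hγpos i (n + 2)).ne'
    have hγn := (hγpos (i + n)).ne'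
    rw [hy, mu_add_three]
    field_simp
  refine ⟨strictMono_nat_of_lt_succ fun n => ?_, hrec⟩
  change y (i + n) / mu γ i (n + 2) < y (i + n + 1) / mu γ i (n + 3)
  rw [hrec n]
  exact lt_add_of_pos_left _
    (div_pos (solution_pos hγpos hx0 hy0 hx hy (i + n)).1 (mu_pos hγpos i (n + 3)))
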